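/- arXiv:math/0509082 — 6 statements merged into one kernel-verified Lean document; each statement's English description precedes it below -/
import Mathlib

section
/- Let (b_1, …, b_k) be a simple continued fraction expansion (SCFE) with value v = cf(b_1, …, b_k), and assume v ≠ 1 and v ≠ −1. If b_1 ≠ 0, then |v| < 1 and v has the same sign as b_1. If b_1 = 0 (so necessarily k ≥ 2), then |v| > 1 and v has the sign opposite to that of b_2. -/
/-- Continued fraction value of a list of integers: `cf [] = 0`,
`cf (b :: t) = 1 / (b - cf t)`, computed in `ℚ` (with the convention `1/0 = 0`). -/
def cf : List ℤ → ℚ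
  | [] => 0
  | b :: t => 1 / ((b : ℚ) - cf t)

/-- The evaluation of a continued fraction is well-defined if no division by zero occurs. -/
def cfWD : List ℤ → Prop
  | [] => True
  | b :: t => ((b : ℚ) ≠ cf t) ∧ cfWD t

/-- A nonempty list of integers `(b_1, …, b_k)` is a simple continued fraction expansion:
consecutive coefficients have non-positive product (alternating signs), every coefficient
except possibly the first is nonzero, and the last coefficient has absolute value at least 2. -/
def SCFE (l : List ℤ) : Prop :=
  l ≠ [] ∧
  (∀ i, i + 1 < l.length → l.getD i 0 * l.getD (i + 1) 0 ≤ 0) ∧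
  (∀ i, 0 < i → i < l.length → l.getD i 0 ≠ 0) ∧
  2 ≤ |l.getLastD 0|

theorem SCFE.tail {a c : ℤ} {t : List ℤ} (h : SCFE (a :: c :: t)) :
    SCFE (c :: t) ∧ c ≠ 0 ∧ a * c ≤ 0 := by
  obtain ⟨-, hmul, hne, hlast⟩ := h
  refine ⟨⟨List.cons_ne_nil _ _, fun i hi => ?_, fun i hi hi' => ?_, ?_⟩, ?_, ?_⟩
  · simpa using hmul (i + 1) (by simpa using hi)
  · simpa using hne (i + 1) (by simp) (by simpa using hi')
  · simpa using hlast
  · simpa using hne 1 (by simp) (by simp)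
  · simpa using hmul 0 (by simp)

theorem SCFE.two_le_abs {a : ℤ} (h : SCFE [a]) : 2 ≤ |a| := by
  simpa using h.2.2.2

/-- The value of an SCFE with nonzero first coefficient lies strictly between `0` and `±1`,
on the side of its first coefficient. -/
theorem SCFE.cf_bounds {a : ℤ} {t : List ℤ} (h : SCFE (a :: t)) :
    (0 < a → 0 < cf (a :: t) ∧ cf (a :: t) < 1) ∧
    (a < 0 → -1 < cf (a :: t) ∧ cf (a :: t) < 0) := by
  have pos_case (x : ℚ) (hx : 1 < x) : 0 < 1 / x ∧ 1 / x < 1 :=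
    ⟨by positivity, by rw [div_lt_one (by linarith)]; exact hx⟩
  have neg_case (x : ℚ) (hx : x < -1) : -1 < 1 / x ∧ 1 / x < 0 := by
    have := pos_case (-x) (by linarith)
    rw [div_neg] at this
    constructor <;> linarith
  induction t generalizing a with
  | nil =>
    have h2 := h.two_le_abs
    refine ⟨fun ha => pos_case _ ?_, fun ha => neg_case _ ?_⟩
    · rw [abs_of_pos ha] at h2
      have : (2 : ℚ) ≤ a := by exact_mod_cast h2
      simp only [cf]
      linarith
    · rw [abs_of_neg ha] at h2
      have : (a : ℚ) ≤ -2 := by exact_mod_cast (by linarith : a ≤ -2)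
      simp only [cf]
      linarith
  | cons c t ih =>
    obtain ⟨ht, hc, hac⟩ := h.tail
    refine ⟨fun ha => pos_case _ ?_, fun ha => neg_case _ ?_⟩
    · have hc' : c < 0 := lt_of_le_of_ne (nonpos_of_mul_nonpos_right hac ha) hc
      have := (ih ht).2 hc'
      have : (1 : ℚ) ≤ a := by exact_mod_cast ha
      linarith
    · have hc' : 0 < c := lt_of_le_of_ne (by nlinarith) hc.symm
      have := (ih ht).1 hc'
      have : (a : ℚ) ≤ -1 := by exact_mod_cast (by linarith [Int.add_one_le_iff.mpr ha] : a ≤ -1)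
      linarith

theorem SCFE.abs_cf_lt_one_and_sign {a : ℤ} {t : List ℤ} (h : SCFE (a :: t)) (ha : a ≠ 0) :
    |cf (a :: t)| < 1 ∧ SignType.sign (cf (a :: t)) = SignType.sign (a : ℚ) := by
  rcases ha.lt_or_gt with ha | ha
  · obtain ⟨h1, h2⟩ := h.cf_bounds.2 ha
    exact ⟨abs_lt.mpr ⟨h1, by linarith⟩, by rw [sign_neg h2, sign_neg (Int.cast_lt_zero.mpr ha)]⟩
  · obtain ⟨h1, h2⟩ := h.cf_bounds.1 ha
    exact ⟨abs_lt.mpr ⟨by linarith, h2⟩, by rw [sign_pos h1, sign_pos (Int.cast_pos.mpr ha)]⟩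

/-- For a SCFE `(b_1, …, b_k)` with value `v ≠ ±1`: if `b_1 ≠ 0` then `|v| < 1`
and `v` has the same sign as `b_1`; if `b_1 = 0` then `|v| > 1` and `v` has the sign opposite
to that of `b_2`. -/
theorem scfe_size (b : List ℤ) (hb : SCFE b) (v : ℚ) (hv : v = cf b)
    (h1 : v ≠ 1) (h2 : v ≠ -1) :
    (b.getD 0 0 ≠ 0 →
      |v| < 1 ∧ SignType.sign v = SignType.sign ((b.getD 0 0 : ℤ) : ℚ)) ∧
    (b.getD 0 0 = 0 →
      2 ≤ b.length ∧ 1 < |v| ∧ SignType.sign v = - SignType.sign ((b.getD 1 0 : ℤ) : ℚ)) := by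
  subst hv
  match b, hb with
  | [], hb => exact absurd rfl hb.1
  | [a], hb =>
    refine ⟨fun ha => hb.abs_cf_lt_one_and_sign ha, fun ha => ?_⟩
    have := hb.two_le_abs
    simp_all
  | a :: c :: t, hb =>
    refine ⟨fun ha => hb.abs_cf_lt_one_and_sign ha, fun ha => ⟨by simp, ?_⟩⟩
    obtain ⟨ht, hc, -⟩ := hb.tail
    obtain ⟨hlt, hsign⟩ := ht.abs_cf_lt_one_and_sign hc
    have ha' : a = 0 := ha
    have hcf : cf (a :: c :: t) = -(cf (c :: t))⁻¹ := by
      rw [cf, ha', Int.cast_zero, zero_sub, one_div, inv_neg]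
    have hne : cf (c :: t) ≠ 0 := by
      rw [← sign_ne_zero, hsign, sign_ne_zero]
      exact_mod_cast hc
    rw [hcf, abs_neg, abs_inv, Left.sign_neg]
    refine ⟨(one_lt_inv₀ (abs_pos.mpr hne)).mpr hlt, ?_⟩
    rcases hne.lt_or_gt with hn | hp
    · rw [sign_neg (inv_lt_zero.mpr hn), ← sign_neg hn]
      exact congrArg _ hsign
    · rw [sign_pos (inv_pos.mpr hp), ← sign_pos hp]
      exact congrArg _ hsign
end

section
/- Let (a_1, …, a_l) and (b_1, …, b_k) be lists of integers with l ≥ 3 and k ≥ 3, such that the evaluations of all prefixes (a_1, …, a_i) for 1 ≤ i ≤ l and (b_1, …, b_j) for 1 ≤ j ≤ k are well-defined. If cf(a_1, …, a_l) = cf(b_1, …, b_k), cf(a_1, …, a_{l−1}) = cf(b_1, …, b_{k−1}), and cf(a_1, …, a_{l−2}) = cf(b_1, …, b_{k−2}), then a_l = b_k. -/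
/-- The integers `(p, q)` obtained by evaluating `cf` as a formal fraction `p / q`. -/
def cfFrac : List ℤ → ℤ × ℤ
  | [] => (0, 1)
  | b :: t => ((cfFrac t).2, b * (cfFrac t).2 - (cfFrac t).1)

theorem cfFrac_spec (l : List ℤ) (h : cfWD l) :
    (cfFrac l).2 ≠ 0 ∧ cf l = (cfFrac l).1 / (cfFrac l).2 := by
  induction l with
  | nil => simp [cfFrac, cf]
  | cons b t ih =>
    obtain ⟨hb, ht⟩ := h
    obtain ⟨hq, hv⟩ := ih ht
    have hq' : ((cfFrac t).2 : ℚ) ≠ 0 := by exact_mod_cast hq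
    rw [hv, ne_eq, eq_div_iff hq', ← sub_eq_zero] at hb
    refine ⟨by simpa [cfFrac] using mod_cast hb, ?_⟩
    simp only [cf, cfFrac, hv]
    push_cast
    rw [sub_div' hq', one_div_div]

theorem cfFrac_det (t : List ℤ) (x : ℤ) :
    (cfFrac (t ++ [x])).1 * (cfFrac t).2 - (cfFrac (t ++ [x])).2 * (cfFrac t).1 = 1 := by
  induction t with
  | nil => simp [cfFrac]
  | cons b t ih =>
    simp only [List.cons_append, cfFrac]
    linear_combination ih

theorem cfFrac_recurrence (t : List ℤ) (x y : ℤ) :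
    cfFrac (t ++ [x, y]) = y • cfFrac (t ++ [x]) - cfFrac t := by
  induction t with
  | nil => ext <;> simp [cfFrac, mul_comm]
  | cons b t ih =>
    ext
    · simp [cfFrac, ih]
    · simp [cfFrac, ih]
      ring

theorem isCoprime_cfFrac_append (t : List ℤ) (x : ℤ) :
    IsCoprime (cfFrac (t ++ [x])).1 (cfFrac (t ++ [x])).2 :=
  ⟨(cfFrac t).2, -(cfFrac t).1, by linear_combination cfFrac_det t x⟩

theorem sq_eq_sq_of_div_eq_div {p q r s : ℤ} (hq : q ≠ 0) (hs : s ≠ 0) (hpq : IsCoprime p q)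
    (hrs : IsCoprime r s) (h : (p : ℚ) / q = r / s) : q ^ 2 = s ^ 2 := by
  rw [div_eq_div_iff (by exact_mod_cast hq) (by exact_mod_cast hs)] at h
  have h' : p * s = r * q := by exact_mod_cast h
  have hqs : q ∣ s := hpq.symm.dvd_of_dvd_mul_left ⟨r, by linear_combination h'⟩
  have hsq : s ∣ q := hrs.symm.dvd_of_dvd_mul_left ⟨p, by linear_combination -h'⟩
  exact Int.natAbs_eq_iff_sq_eq.1 (Nat.dvd_antisymm (Int.natAbs_dvd_natAbs.2 hqs)
    (Int.natAbs_dvd_natAbs.2 hsq))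

theorem cf_append_sub (t : List ℤ) (x : ℤ) (ht : cfWD t) (htx : cfWD (t ++ [x])) :
    (cf (t ++ [x]) - cf t)⁻¹ = (cfFrac (t ++ [x])).2 * (cfFrac t).2 := by
  obtain ⟨hq, hv⟩ := cfFrac_spec t ht
  obtain ⟨hq', hv'⟩ := cfFrac_spec _ htx
  have h := congrArg (Int.cast (R := ℚ)) (cfFrac_det t x)
  push_cast at h
  rw [hv, hv', div_sub_div _ _ (by exact_mod_cast hq') (by exact_mod_cast hq), h, one_div, inv_inv]

theorem last_mul_sq_eq (t : List ℤ) (x y : ℤ) (ht : cfWD t) (htx : cfWD (t ++ [x]))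
    (htxy : cfWD (t ++ [x, y])) :
    (y : ℚ) * (cfFrac (t ++ [x])).2 ^ 2 =
      (cf (t ++ [x, y]) - cf (t ++ [x]))⁻¹ + (cf (t ++ [x]) - cf t)⁻¹ := by
  have h := cf_append_sub (t ++ [x]) y htx (by simpa using htxy)
  simp only [List.append_assoc, List.cons_append, List.nil_append] at h
  rw [h, cf_append_sub t x ht htx, cfFrac_recurrence]
  simp only [Prod.snd_sub, Prod.smul_snd, smul_eq_mul]
  push_cast
  ring

theorem exists_append_pair_of_wellDefined_prefixes (a : List ℤ) (ha : 3 ≤ a.length)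
    (hwa : ∀ i, 1 ≤ i → i ≤ a.length → cfWD (a.take i)) :
    ∃ t x y, a = t ++ [x, y] ∧ cfWD t ∧ cfWD (t ++ [x]) ∧ cfWD (t ++ [x, y]) := by
  rcases a.eq_nil_or_concat' with rfl | ⟨s, y, rfl⟩
  · simp at ha
  rcases s.eq_nil_or_concat' with rfl | ⟨t, x, rfl⟩
  · simp at ha
  simp only [List.append_assoc, List.cons_append, List.nil_append,
    List.length_append, List.length_cons, List.length_nil] at *
  refine ⟨t, x, y, rfl, ?_, ?_, ?_⟩
  · simpa using hwa t.length (by omega) (by omega)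
  · simpa [List.take_append, List.take_of_length_le] using hwa (t.length + 1) (by omega) (by omega)
  · simpa [List.take_append, List.take_of_length_le] using hwa (t.length + 2) (by omega) (by omega)

/-- If two lists of integers of length at least 3, all of whose prefix
evaluations are well-defined, have equal continued fraction values for the full lists and for
the lists with the last one and last two entries removed, then their last entries coincide. -/
theorem last_coefficients_equal (a b : List ℤ) (ha : 3 ≤ a.length) (hb : 3 ≤ b.length)
    (hwa : ∀ i, 1 ≤ i → i ≤ a.length → cfWD (a.take i))
    (hwb : ∀ i, 1 ≤ i → i ≤ b.length → cfWD (b.take i))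
    (h0 : cf a = cf b)
    (h1 : cf a.dropLast = cf b.dropLast)
    (h2 : cf a.dropLast.dropLast = cf b.dropLast.dropLast) :
    a.getLastD 0 = b.getLastD 0 := by
  obtain ⟨t, x, y, rfl, hat, hatx, hatxy⟩ := exists_append_pair_of_wellDefined_prefixes a ha hwa
  obtain ⟨u, z, w, rfl, hbu, hbuz, hbuzw⟩ := exists_append_pair_of_wellDefined_prefixes b hb hwb
  have hdrop (s : List ℤ) (m n : ℤ) : (s ++ [m, n]).dropLast = s ++ [m] := by
    simp [List.dropLast_append_of_ne_nil]
  simp only [hdrop, List.dropLast_concat] at h1 h2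
  obtain ⟨hq, hv⟩ := cfFrac_spec _ hatx
  obtain ⟨hq', hv'⟩ := cfFrac_spec _ hbuz
  have hsq := sq_eq_sq_of_div_eq_div hq hq' (isCoprime_cfFrac_append t x)
    (isCoprime_cfFrac_append u z) (by rw [← hv, ← hv', h1])
  have key := last_mul_sq_eq t x y hat hatx hatxy
  rw [h0, h1, h2, ← last_mul_sq_eq u z w hbu hbuz hbuzw] at key
  norm_cast at key
  rw [hsq] at key
  have hyw : y = w := mul_right_cancel₀ (pow_ne_zero 2 hq') key
  simp [List.getLastD_eq_getLast?, hyw]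
end

section
/- Let n_1, …, n_k be integers (k ≥ 1) such that the evaluations of (n_1, …, n_k) and of (n_1, …, n_{k−1}) are well-defined. Let W = X_1^{n_1} X_2^{n_2} ⋯ X_k^{n_k} ∈ SL(2, ℤ), where X_j = B if j is odd and X_j = A if j is even (so the letters alternate starting with B^{n_1}). Write (x, y) for the first column of W and (t, u) for its second column. If k is odd (the word ends in B^{n_k}), then y ≠ 0, u ≠ 0, x/y = cf(n_1, …, n_k), and t/u = cf(n_1, …, n_{k−1}). If k is even (the word ends in A^{n_k}), then y ≠ 0, u ≠ 0, x/y = cf(n_1, …, n_{k−1}), and t/u = cf(n_1, …, n_k). -/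
abbrev SL2Z := Matrix.SpecialLinearGroup (Fin 2) ℤ

def A : SL2Z := ⟨!![1, -1; 0, 1], by norm_num [Matrix.det_fin_two_of]⟩
def B : SL2Z := ⟨!![1, 0; 1, 1], by norm_num [Matrix.det_fin_two_of]⟩

/-- Alternating word `X^{n_1} Y^{n_2} X^{n_3} ⋯` in `SL(2,ℤ)` (integer exponents). -/
def altProd (X Y : SL2Z) : List ℤ → SL2Z
  | [] => 1
  | n :: t => X ^ n * altProd Y X t

theorem coe_A_zpow (n : ℤ) : ((A ^ n : SL2Z) : Matrix (Fin 2) (Fin 2) ℤ) = !![1, -n; 0, 1] := by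
  have hA : A = ModularGroup.T⁻¹ := by
    ext i j
    rw [ModularGroup.coe_T_inv]
    rfl
  rw [hA, inv_zpow', ModularGroup.coe_T_zpow]

theorem coe_B_zpow (n : ℤ) : ((B ^ n : SL2Z) : Matrix (Fin 2) (Fin 2) ℤ) = !![1, 0; n, 1] := by
  have hB : B = ModularGroup.S * A * ModularGroup.S⁻¹ := by decide
  rw [hB, conj_zpow, Matrix.SpecialLinearGroup.coe_mul, Matrix.SpecialLinearGroup.coe_mul,
    coe_A_zpow, Matrix.SpecialLinearGroup.coe_inv, ModularGroup.coe_S]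
  simp [Matrix.adjugate_fin_two]

theorem altProd_B_cons_apply_zero (X : SL2Z) (b : ℤ) (l : List ℤ) (j : Fin 2) :
    altProd B X (b :: l) 0 j = altProd X B l 0 j := by
  simp [altProd, coe_B_zpow, Matrix.mul_apply]

theorem altProd_B_cons_apply_one (X : SL2Z) (b : ℤ) (l : List ℤ) (j : Fin 2) :
    altProd B X (b :: l) 1 j = b * altProd X B l 0 j + altProd X B l 1 j := by
  simp [altProd, coe_B_zpow, Matrix.mul_apply]

theorem altProd_A_cons_apply_zero (X : SL2Z) (b : ℤ) (l : List ℤ) (j : Fin 2) :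
    altProd A X (b :: l) 0 j = altProd X A l 0 j - b * altProd X A l 1 j := by
  simp [altProd, coe_A_zpow, Matrix.mul_apply, sub_eq_add_neg]

theorem altProd_A_cons_apply_one (X : SL2Z) (b : ℤ) (l : List ℤ) (j : Fin 2) :
    altProd A X (b :: l) 1 j = altProd X A l 1 j := by
  simp [altProd, coe_A_zpow, Matrix.mul_apply]

/-- The column of an alternating word that the last letter moves. Swapping the letters replaces
the ratio `r` of that column by `-1 / r`. -/
theorem altProd_last_column (l : List ℤ) (h : cfWD l) :
    (altProd B A l 1 (Fin.ofNat 2 (l.length + 1)) ≠ 0 ∧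
      (altProd B A l 0 (Fin.ofNat 2 (l.length + 1)) : ℚ) / altProd B A l 1 (Fin.ofNat 2 (l.length + 1)) = cf l) ∧
    (altProd A B l 0 (Fin.ofNat 2 l.length) ≠ 0 ∧
      (altProd A B l 1 (Fin.ofNat 2 l.length) : ℚ) / altProd A B l 0 (Fin.ofNat 2 l.length) = -cf l) := by
  induction l with
  | nil => simp [altProd, cf]
  | cons b t ih =>
    obtain ⟨hb, ht⟩ := h
    obtain ⟨⟨hy, hxy⟩, hx, hyx⟩ := ih ht
    have hcol : Fin.ofNat 2 ((b :: t).length + 1) = Fin.ofNat 2 t.length :=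
      Fin.ext (Nat.add_mod_right t.length 2)
    have hcol' : Fin.ofNat 2 (b :: t).length = Fin.ofNat 2 (t.length + 1) := rfl
    rw [hcol, hcol']
    simp only [altProd_B_cons_apply_zero, altProd_B_cons_apply_one, altProd_A_cons_apply_zero,
      altProd_A_cons_apply_one, cf]
    generalize altProd B A t 0 (Fin.ofNat 2 (t.length + 1)) = x at *
    generalize altProd B A t 1 (Fin.ofNat 2 (t.length + 1)) = y at *
    generalize altProd A B t 0 (Fin.ofNat 2 t.length) = x' at *
    generalize altProd A B t 1 (Fin.ofNat 2 t.length) = y' at *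
    have hyQ : (y : ℚ) ≠ 0 := by exact_mod_cast hy
    have hxQ : (x' : ℚ) ≠ 0 := by exact_mod_cast hx
    have hd : (b : ℚ) - cf t ≠ 0 := sub_ne_zero.mpr hb
    have hx_eq : (x : ℚ) = cf t * y := (div_eq_iff hyQ).mp hxy
    have hy_eq : (y' : ℚ) = -cf t * x' := (div_eq_iff hxQ).mp hyx
    have hB : (b * x' + y' : ℚ) = (b - cf t) * x' := by rw [hy_eq]; ring
    have hA : (x - b * y : ℚ) = -((b - cf t) * y) := by rw [hx_eq]; ring
    refine ⟨⟨?_, ?_⟩, ?_, ?_⟩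
    · have : (b * x' + y' : ℚ) ≠ 0 := by rw [hB]; exact mul_ne_zero hd hxQ
      exact_mod_cast this
    · push_cast
      rw [hB]
      field_simp
    · have : (x - b * y : ℚ) ≠ 0 := by rw [hA]; exact neg_ne_zero.mpr (mul_ne_zero hd hyQ)
      exact_mod_cast this
    · push_cast
      rw [hA]
      field_simp

/-- Appending a letter to an alternating word leaves one of the columns unchanged. -/
theorem altProd_append_singleton_column (l : List ℤ) (m : ℤ) :
    (∀ i, altProd B A (l ++ [m]) i (Fin.ofNat 2 (l.length + 1)) = altProd B A l i (Fin.ofNat 2 (l.length + 1))) ∧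
    (∀ i, altProd A B (l ++ [m]) i (Fin.ofNat 2 l.length) = altProd A B l i (Fin.ofNat 2 l.length)) := by
  induction l with
  | nil =>
    simp [altProd, coe_A_zpow, coe_B_zpow, Fin.forall_fin_two]
  | cons b t ih =>
    obtain ⟨ihB, ihA⟩ := ih
    have hcol : Fin.ofNat 2 ((b :: t).length + 1) = Fin.ofNat 2 t.length :=
      Fin.ext (Nat.add_mod_right t.length 2)
    have hcol' : Fin.ofNat 2 (b :: t).length = Fin.ofNat 2 (t.length + 1) := rfl
    rw [hcol, hcol']
    simp only [List.cons_append, Fin.forall_fin_two, altProd_B_cons_apply_zero,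
      altProd_B_cons_apply_one, altProd_A_cons_apply_zero, altProd_A_cons_apply_one, ihA, ihB,
      and_self]

/-- for the alternating word `W = B^{n_1} A^{n_2} B^{n_3} ⋯` built on a nonempty
list `(n_1, …, n_k)` whose evaluation and whose truncated evaluation are well-defined, the
columns `(x,y)` and `(t,u)` of `W` satisfy: if `k` is odd then `y, u ≠ 0`,
`x/y = cf(n_1, …, n_k)` and `t/u = cf(n_1, …, n_{k-1})`; if `k` is even then `y, u ≠ 0`,
`x/y = cf(n_1, …, n_{k-1})` and `t/u = cf(n_1, …, n_k)`. -/
theorem columns_of_alternating_word (n : List ℤ) (hk : 1 ≤ n.length)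
    (h1 : cfWD n) (h2 : cfWD n.dropLast)
    (W : SL2Z) (hW : W = altProd B A n) :
    (Odd n.length →
      (W : Matrix (Fin 2) (Fin 2) ℤ) 1 0 ≠ 0 ∧
      (W : Matrix (Fin 2) (Fin 2) ℤ) 1 1 ≠ 0 ∧
      ((W : Matrix (Fin 2) (Fin 2) ℤ) 0 0 : ℚ) / ((W : Matrix (Fin 2) (Fin 2) ℤ) 1 0 : ℚ)
        = cf n ∧
      ((W : Matrix (Fin 2) (Fin 2) ℤ) 0 1 : ℚ) / ((W : Matrix (Fin 2) (Fin 2) ℤ) 1 1 : ℚ)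
        = cf n.dropLast) ∧
    (Even n.length →
      (W : Matrix (Fin 2) (Fin 2) ℤ) 1 0 ≠ 0 ∧
      (W : Matrix (Fin 2) (Fin 2) ℤ) 1 1 ≠ 0 ∧
      ((W : Matrix (Fin 2) (Fin 2) ℤ) 0 0 : ℚ) / ((W : Matrix (Fin 2) (Fin 2) ℤ) 1 0 : ℚ)
        = cf n.dropLast ∧
      ((W : Matrix (Fin 2) (Fin 2) ℤ) 0 1 : ℚ) / ((W : Matrix (Fin 2) (Fin 2) ℤ) 1 1 : ℚ)
        = cf n) := by
  subst hW
  have hne : n ≠ [] := List.ne_nil_of_length_pos hk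
  obtain ⟨⟨hy, hxy⟩, -⟩ := altProd_last_column n h1
  obtain ⟨⟨hu, htu⟩, -⟩ := altProd_last_column n.dropLast h2
  have happ := (altProd_append_singleton_column n.dropLast (n.getLast hne)).1
  rw [List.dropLast_append_getLast] at happ
  rw [← happ] at hu
  rw [← happ, ← happ] at htu
  rw [List.length_dropLast, Nat.sub_add_cancel hk] at hu htu
  constructor
  · rintro ⟨k, hlen⟩
    have hcol : Fin.ofNat 2 n.length = 1 := Fin.ext (show n.length % 2 = 1 by lia)
    have hcol' : Fin.ofNat 2 (n.length + 1) = 0 :=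
      Fin.ext (show (n.length + 1) % 2 = 0 by lia)
    rw [hcol] at hu htu
    rw [hcol'] at hy hxy
    exact ⟨hy, hu, hxy, htu⟩
  · rintro ⟨k, hlen⟩
    have hcol : Fin.ofNat 2 n.length = 0 := Fin.ext (show n.length % 2 = 0 by lia)
    have hcol' : Fin.ofNat 2 (n.length + 1) = 1 :=
      Fin.ext (show (n.length + 1) % 2 = 1 by lia)
    rw [hcol] at hu htu
    rw [hcol'] at hy hxy
    exact ⟨hu, hy, htu, hxy⟩
end

section
/- Let W ∈ SL(2, ℤ) with first column (x, y) and y ≠ 0, and let n_1, …, n_k be integers such that the evaluations of (n_1, …, n_k) and of (n_1, …, n_{k−1}) are well-defined and x/y = cf(n_1, …, n_k). Then there exist N ∈ ℤ and ε ∈ {1, −1} such that either W = ε · V · A^N, where V = X_1^{n_1} ⋯ X_k^{n_k} is the alternating word with X_j = B for j odd and X_j = A for j even, or W = ε · B·A·B · V' · A^N, where V' = Y_1^{n_1} ⋯ Y_k^{n_k} is the alternating word with Y_j = A for j odd and Y_j = B for j even. -/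
/-- The product `∏ (B A B · A^{b_i}) · B A B`, whose first column represents `cf` of the list. -/
def cfMatrix : List ℤ → SL2Z
  | [] => B * A * B
  | b :: t => B * A * B * A ^ b * cfMatrix t

theorem coe_BAB : ((B * A * B : SL2Z) : Matrix (Fin 2) (Fin 2) ℤ) = !![0, -1; 1, 0] := by
  decide

theorem BAB_mul_self : B * A * B * (B * A * B) = (-1 : SL2Z) := by
  decide

theorem BAB_mul_A_zpow (n : ℤ) : B * A * B * A ^ n = B ^ n * (B * A * B) := by
  have h : B * A * B * A * (B * A * B)⁻¹ = B := by
    rw [mul_inv_eq_iff_eq_mul]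
    decide
  conv_rhs => rw [← h, conj_zpow, h]
  group

theorem cfMatrix_first_column (l : List ℤ) (hl : cfWD l) :
    (cfMatrix l 0 0 : ℚ) = cfMatrix l 1 0 * cf l := by
  induction l with
  | nil => rw [cfMatrix, coe_BAB]; simp [cf]
  | cons b t ih =>
    have hb : (b : ℚ) - cf t ≠ 0 := sub_ne_zero.mpr hl.1
    have h0 : cfMatrix (b :: t) 0 0 = -cfMatrix t 1 0 := by
      rw [cfMatrix, Matrix.SpecialLinearGroup.coe_mul, Matrix.SpecialLinearGroup.coe_mul,
        coe_BAB, coe_A_zpow]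
      simp [Matrix.mul_apply, Fin.sum_univ_two]
    have h1 : cfMatrix (b :: t) 1 0 = cfMatrix t 0 0 - b * cfMatrix t 1 0 := by
      rw [cfMatrix, Matrix.SpecialLinearGroup.coe_mul, Matrix.SpecialLinearGroup.coe_mul,
        coe_BAB, coe_A_zpow]
      simp [Matrix.mul_apply, Fin.sum_univ_two]
      ring
    rw [h0, h1, cf]
    push_cast
    rw [ih hl.2]
    field_simp
    ring

theorem cfMatrix_eq_altProd (l : List ℤ) :
    (cfMatrix l = altProd B A l ∨ cfMatrix l = -altProd B A l) ∨
      (cfMatrix l = B * A * B * altProd A B l ∨ cfMatrix l = -(B * A * B * altProd A B l)) := by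
  induction l with
  | nil => simp [cfMatrix, altProd]
  | cons b t ih =>
    have key : B * A * B * A ^ b * (B * A * B * altProd A B t) = -altProd B A (b :: t) := by
      rw [BAB_mul_A_zpow, mul_assoc (B ^ b), ← mul_assoc (B * A * B) (B * A * B), BAB_mul_self,
        altProd, neg_one_mul, mul_neg]
    rcases ih with (h | h) | (h | h) <;> rw [cfMatrix, h]
    · exact Or.inr (Or.inl (by rw [altProd, mul_assoc]))
    · exact Or.inr (Or.inr (by rw [altProd, mul_neg, mul_assoc]))
    · exact Or.inl (Or.inr key)
    · exact Or.inl (Or.inl (by rw [mul_neg, key, neg_neg]))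

theorem eq_or_eq_neg_A_zpow (g : SL2Z) (hg : g 1 0 = 0) :
    ∃ N : ℤ, g = A ^ N ∨ g = -A ^ N := by
  have hdet := g.det_coe
  rw [Matrix.det_fin_two, hg, mul_zero, sub_zero] at hdet
  rcases Int.mul_eq_one_iff_eq_one_or_neg_one.mp hdet with ⟨h0, h1⟩ | ⟨h0, h1⟩
  · refine ⟨-g 0 1, Or.inl ?_⟩
    ext i j
    rw [coe_A_zpow]
    fin_cases i <;> fin_cases j <;> simp [h0, h1, hg]
  · refine ⟨g 0 1, Or.inr ?_⟩
    ext i j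
    rw [Matrix.SpecialLinearGroup.coe_neg, coe_A_zpow]
    fin_cases i <;> fin_cases j <;> simp [h0, h1, hg]

theorem exists_eq_mul_A_zpow (M W : SL2Z) (h : M 0 0 * W 1 0 = M 1 0 * W 0 0) :
    ∃ N : ℤ, W = M * A ^ N ∨ W = -(M * A ^ N) := by
  obtain ⟨N, hN⟩ := eq_or_eq_neg_A_zpow (M⁻¹ * W) (by
    rw [Matrix.SpecialLinearGroup.coe_mul, Matrix.SpecialLinearGroup.coe_inv,
      Matrix.adjugate_fin_two, Matrix.mul_apply, Fin.sum_univ_two]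
    simp
    linarith)
  refine ⟨N, hN.imp (fun e => ?_) (fun e => ?_)⟩
  · rw [← e, mul_inv_cancel_left]
  · rw [← mul_neg, ← e, mul_inv_cancel_left]

/-- if `W ∈ SL(2,ℤ)` has first column `(x,y)` with `y ≠ 0` and
`x/y = cf(n_1, …, n_k)` for a list whose evaluation and truncated evaluation are well-defined,
then `W = ± V A^N` or `W = ± B A B V' A^N`, where `V = B^{n_1} A^{n_2} ⋯` and
`V' = A^{n_1} B^{n_2} ⋯` are the alternating words on `(n_1, …, n_k)`. -/
theorem word_from_continued_fraction (W : SL2Z)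
    (hy : (W : Matrix (Fin 2) (Fin 2) ℤ) 1 0 ≠ 0)
    (n : List ℤ) (h1 : cfWD n) (h2 : cfWD n.dropLast)
    (hx : ((W : Matrix (Fin 2) (Fin 2) ℤ) 0 0 : ℚ) /
          ((W : Matrix (Fin 2) (Fin 2) ℤ) 1 0 : ℚ) = cf n) :
    ∃ (N : ℤ) (ε : ℤ), (ε = 1 ∨ ε = -1) ∧
      ((W : Matrix (Fin 2) (Fin 2) ℤ)
          = ε • ((altProd B A n * A ^ N : SL2Z) : Matrix (Fin 2) (Fin 2) ℤ) ∨
       (W : Matrix (Fin 2) (Fin 2) ℤ)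
          = ε • ((B * A * B * altProd A B n * A ^ N : SL2Z) : Matrix (Fin 2) (Fin 2) ℤ)) := by
  have hcol : cfMatrix n 0 0 * W 1 0 = cfMatrix n 1 0 * W 0 0 := by
    have hy' : (W 1 0 : ℚ) ≠ 0 := by exact_mod_cast hy
    have hM := cfMatrix_first_column n h1
    rw [div_eq_iff hy'] at hx
    have : (cfMatrix n 0 0 * W 1 0 : ℚ) = cfMatrix n 1 0 * W 0 0 := by
      rw [hM, hx]
      ring
    exact_mod_cast this
  obtain ⟨N, hN⟩ := exists_eq_mul_A_zpow (cfMatrix n) W hcol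
  have hsign : ∀ V : SL2Z, cfMatrix n = V ∨ cfMatrix n = -V →
      ∃ ε : ℤ, (ε = 1 ∨ ε = -1) ∧ (W : Matrix (Fin 2) (Fin 2) ℤ) =
        ε • ((V * A ^ N : SL2Z) : Matrix (Fin 2) (Fin 2) ℤ) := by
    rintro V (hV | hV) <;> rw [hV] at hN <;> rcases hN with hW | hW
    · exact ⟨1, Or.inl rfl, by rw [one_smul, hW]⟩
    · exact ⟨-1, Or.inr rfl, by rw [neg_one_smul, hW, Matrix.SpecialLinearGroup.coe_neg]⟩
    · exact ⟨-1, Or.inr rfl, by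
        rw [neg_one_smul, hW, neg_mul, Matrix.SpecialLinearGroup.coe_neg]⟩
    · exact ⟨1, Or.inl rfl, by rw [one_smul, hW, neg_mul, neg_neg]⟩
  rcases cfMatrix_eq_altProd n with h | h
  · obtain ⟨ε, hε, hW⟩ := hsign _ h
    exact ⟨N, ε, hε, Or.inl hW⟩
  · obtain ⟨ε, hε, hW⟩ := hsign _ h
    exact ⟨N, ε, hε, Or.inr hW⟩
end

section
/- Let (b_1, …, b_k) be a simple continued fraction expansion (SCFE) with k odd, b_1 ∉ {0, 1}, and value cf(b_1, …, b_k) ∉ {1, −1}. Set W = B^{b_1} A^{b_2} B^{b_3} ⋯ B^{b_k} ∈ SL(2, ℤ) (letters alternating, starting and ending with a power of B), set H = A^{−1} B^{−1}, and for N ∈ ℤ let X(N) = (W A^N)^{−1} H (W A^N), with first column (p(N), q(N)). Then: (i) q(N) does not depend on N; (ii) q(N) ≠ 0 and p(N)/q(N) = N + cf(b'_1), where b'_1 = (−b_k, …, −b_3, −b_2, −b_1 + 1, b_1, b_2, …, b_k); and (iii) the list b'_1 is itself a simple continued fraction expansion (SCFE). -/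
/-- The matrix X(N) = (W A^N)⁻¹ H (W A^N), where W = B^{b_1} A^{b_2} ⋯ B^{b_k} and
H = A⁻¹ B⁻¹. -/
def Xmat (b : List ℤ) (N : ℤ) : SL2Z :=
  (altProd B A b * A ^ N)⁻¹ * (A⁻¹ * B⁻¹) * (altProd B A b * A ^ N)

/-- p(N): the (1,1)-entry of X(N). -/
def pEnt (b : List ℤ) (N : ℤ) : ℤ := (Xmat b N : Matrix (Fin 2) (Fin 2) ℤ) 0 0

/-- q(N): the (2,1)-entry of X(N). -/
def qEnt (b : List ℤ) (N : ℤ) : ℤ := (Xmat b N : Matrix (Fin 2) (Fin 2) ℤ) 1 0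

/-- The list b'_1 = (−b_k, …, −b_2, −b_1 + 1, b_1, b_2, …, b_k). -/
def bPrime1 (b : List ℤ) : List ℤ :=
  (b.tail.map fun x => -x).reverse ++ [1 - b.headD 0] ++ b

theorem scfe_iff (l : List ℤ) :
    SCFE l ↔ l ≠ [] ∧ l.IsChain (fun x y => x * y ≤ 0) ∧ (∀ x ∈ l.tail, x ≠ 0) ∧
      2 ≤ |l.getLastD 0| := by
  unfold SCFE
  refine and_congr_right fun _ => and_congr ?_ (and_congr_left fun _ => ?_)
  · rw [List.isChain_iff_getElem]
    refine forall_congr' fun i => forall_congr' fun hi => ?_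
    rw [List.getD_eq_getElem _ _ (by omega), List.getD_eq_getElem _ _ hi]
  · constructor
    · intro h x hx
      obtain ⟨i, hi, rfl⟩ := List.mem_iff_getElem.1 hx
      rw [List.length_tail] at hi
      have := h (i + 1) (by omega) (by omega)
      rwa [List.getD_eq_getElem _ _ (by omega), ← List.getElem_tail] at this
    · intro h i hi hil
      obtain ⟨j, rfl⟩ := Nat.exists_eq_succ_of_ne_zero hi.ne'
      rw [List.getD_eq_getElem _ _ hil]
      have := h (l.tail[j]'(by rw [List.length_tail]; omega)) (List.getElem_mem _)
      rwa [List.getElem_tail] at this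

/-- The value of a continued fraction with nonzero alternating coefficients lies in `(-1, 1)` and
has the sign of the first coefficient, and no division by zero occurs in its evaluation. -/
theorem cfWD_and_cf_bounds (b : ℤ) (t : List ℤ)
    (hc : (b :: t).IsChain (fun x y => x * y ≤ 0)) (hne : ∀ x ∈ b :: t, x ≠ 0)
    (hl : 2 ≤ |(b :: t).getLastD 0|) :
    cfWD (b :: t) ∧ 0 < (b : ℚ) * cf (b :: t) ∧ |cf (b :: t)| < 1 := by
  induction t generalizing b with
  | nil =>
    have h2 : (2 : ℚ) ≤ |(b : ℚ)| := by
      simp only [List.getLastD_cons, List.getLastD_nil] at hl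
      exact_mod_cast hl
    have hb : (b : ℚ) ≠ 0 := by
      intro h
      norm_num [h] at h2
    refine ⟨⟨hb, trivial⟩, ?_, ?_⟩
    · simp [cf, hb]
    · simp only [cf, sub_zero, abs_div, abs_one]
      rw [div_lt_one (by linarith)]
      linarith
  | cons c t ih =>
    obtain ⟨hbc, hc'⟩ := List.isChain_cons_cons.1 hc
    obtain ⟨hwd, hpos, -⟩ := ih c hc' (fun x hx => hne x (List.mem_cons_of_mem _ hx))
      (by simpa using hl)
    have hb : b ≠ 0 := hne b (by simp)
    have hc0 : c ≠ 0 := hne c (by simp)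
    set v := cf (c :: t) with hv
    have key : (0 < (b : ℚ) ∧ 1 < (b : ℚ) - v) ∨ ((b : ℚ) < 0 ∧ (b : ℚ) - v < -1) := by
      rcases lt_or_gt_of_ne hb with hb | hb
      · have hcp : 0 < c := lt_of_le_of_ne (by nlinarith) hc0.symm
        have hv' : 0 < v := pos_of_mul_pos_right hpos (by exact_mod_cast hcp.le)
        have : (b : ℚ) ≤ -1 := by exact_mod_cast (by omega : b ≤ -1)
        exact Or.inr ⟨by linarith, by linarith⟩
      · have hcp : c < 0 := lt_of_le_of_ne (by nlinarith) hc0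
        have hcq : (c : ℚ) < 0 := by exact_mod_cast hcp
        have hv' : v < 0 := by nlinarith
        have : (1 : ℚ) ≤ b := by exact_mod_cast (by omega : 1 ≤ b)
        exact Or.inl ⟨by linarith, by linarith⟩
    have hcf : cf (b :: c :: t) = 1 / ((b : ℚ) - v) := rfl
    rw [hcf, abs_div, abs_one]
    rcases key with ⟨h1, h2⟩ | ⟨h1, h2⟩
    · refine ⟨⟨fun h => by rw [h, sub_self] at h2; linarith, hwd⟩, ?_, ?_⟩
      · have : 0 < (b : ℚ) - v := by linarith
        positivity
      · rw [abs_of_pos (by linarith), div_lt_one (by linarith)]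
        exact h2
    · refine ⟨⟨fun h => by rw [h, sub_self] at h2; linarith, hwd⟩, ?_, ?_⟩
      · exact mul_pos_of_neg_of_neg h1 (one_div_neg.2 (by linarith))
      · rw [abs_of_neg (by linarith), div_lt_one (by linarith)]
        linarith

/-- The quarter turn, which conjugates `B` to `A` and `A` to `B`. -/
def quarterTurn : SL2Z := ⟨!![0, 1; -1, 0], by norm_num [Matrix.det_fin_two_of]⟩

/-- The product of the matrices `B ^ b * quarterTurn = !![0, 1; -1, b]`, which act on fractions
by `z ↦ 1 / (b - z)`. -/
def cfProd : List ℤ → SL2Z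
  | [] => 1
  | b :: t => B ^ b * quarterTurn * cfProd t

theorem coe_quarterTurn : (quarterTurn : Matrix (Fin 2) (Fin 2) ℤ) = !![0, 1; -1, 0] := rfl

theorem quarterTurn_mul_B : quarterTurn * B = A * quarterTurn := by decide

theorem quarterTurn_mul_A : quarterTurn * A = B * quarterTurn := by decide

theorem A_inv_mul_B_inv : A⁻¹ * B⁻¹ = B * quarterTurn := by decide

theorem quarterTurn_sq_mul_self : quarterTurn ^ 2 * quarterTurn ^ 2 = 1 := by decide

theorem quarterTurn_sq_commute (M : SL2Z) : Commute (quarterTurn ^ 2) M := by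
  have h : quarterTurn ^ 2 = -1 := by decide
  rw [h]
  exact Commute.neg_one_left M

theorem quarterTurn_mul_B_zpow (n : ℤ) : quarterTurn * B ^ n = A ^ n * quarterTurn :=
  (show SemiconjBy quarterTurn B A from quarterTurn_mul_B).zpow_right n

theorem quarterTurn_mul_A_zpow (n : ℤ) : quarterTurn * A ^ n = B ^ n * quarterTurn :=
  (show SemiconjBy quarterTurn A B from quarterTurn_mul_A).zpow_right n

theorem quarterTurn_mul_altProd (l : List ℤ) :
    quarterTurn * altProd B A l = altProd A B l * quarterTurn ∧
      quarterTurn * altProd A B l = altProd B A l * quarterTurn := by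
  induction l with
  | nil => simp [altProd]
  | cons b t ih =>
    simp only [altProd]
    constructor
    · rw [← mul_assoc, quarterTurn_mul_B_zpow, mul_assoc, ih.2, mul_assoc]
    · rw [← mul_assoc, quarterTurn_mul_A_zpow, mul_assoc, ih.1, mul_assoc]

theorem cfProd_eq_altProd (l : List ℤ) :
    cfProd l = altProd B A l * quarterTurn ^ l.length := by
  induction l with
  | nil => simp [cfProd, altProd]
  | cons b t ih =>
    rw [cfProd, ih, altProd, mul_assoc, ← mul_assoc quarterTurn, (quarterTurn_mul_altProd t).1,
      List.length_cons, pow_succ']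
    simp only [mul_assoc]

theorem cfProd_append (l m : List ℤ) : cfProd (l ++ m) = cfProd l * cfProd m := by
  induction l with
  | nil => simp [cfProd]
  | cons b t ih => simp only [List.cons_append, cfProd, ih, mul_assoc]

theorem cfProd_neg_reverse (l : List ℤ) :
    cfProd (l.map fun x => -x).reverse =
      quarterTurn * (cfProd l)⁻¹ * quarterTurn⁻¹ * (quarterTurn ^ 2) ^ l.length := by
  induction l with
  | nil => simp [cfProd]
  | cons b t ih =>
    have hz := ((quarterTurn_sq_commute (B ^ (-b) * quarterTurn)).pow_left t.length).eq
    rw [List.map_cons, List.reverse_cons, cfProd_append, ih, mul_assoc, cfProd, cfProd, cfProd,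
      mul_one, hz, List.length_cons, pow_succ' (quarterTurn ^ 2) t.length]
    have hq : quarterTurn⁻¹ * quarterTurn ^ 2 = quarterTurn := by group
    simp only [mul_inv_rev, ← zpow_neg, mul_assoc]
    rw [← mul_assoc quarterTurn⁻¹ (quarterTurn ^ 2), hq]

theorem cf_eq_cfProd (l : List ℤ) (h : cfWD l) :
    (cfProd l 1 1 : ℤ) ≠ 0 ∧ cf l = (cfProd l 0 1 : ℚ) / (cfProd l 1 1 : ℚ) := by
  induction l with
  | nil => simp [cfProd, cf]
  | cons b t ih =>
    obtain ⟨hb, ht⟩ := h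
    obtain ⟨hd, hv⟩ := ih ht
    have e0 : (cfProd (b :: t) 0 1 : ℤ) = cfProd t 1 1 := by
      simp [cfProd, coe_B_zpow, coe_quarterTurn, Matrix.mul_apply, Fin.sum_univ_two]
    have e1 : (cfProd (b :: t) 1 1 : ℤ) = b * cfProd t 1 1 - cfProd t 0 1 := by
      simp [cfProd, coe_B_zpow, coe_quarterTurn, Matrix.mul_apply, Fin.sum_univ_two]
      ring
    have hd' : ((cfProd t 1 1 : ℤ) : ℚ) ≠ 0 := by exact_mod_cast hd
    have hsub : (b : ℚ) - cf t = (cfProd (b :: t) 1 1 : ℤ) / (cfProd t 1 1 : ℤ) := by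
      rw [hv, e1]
      push_cast
      field_simp
    constructor
    · intro h0
      rw [h0] at hsub
      apply hb
      rw [← sub_eq_zero, hsub]
      simp
    · rw [cf, hsub, e0, one_div_div]

theorem conj_altProd_eq_cfProd (b : List ℤ) (hodd : Odd b.length) :
    (altProd B A b)⁻¹ * (A⁻¹ * B⁻¹) * altProd B A b =
      cfProd (bPrime1 b) * quarterTurn⁻¹ := by
  cases b with
  | nil => simp at hodd
  | cons c t =>
    obtain ⟨j, hj⟩ := hodd
    have ht : t.length = 2 * j := by simpa using hj
    have hz : quarterTurn ^ (2 * j) = (quarterTurn ^ 2) ^ j := pow_mul _ _ _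
    have hz1 : (quarterTurn ^ 2) ^ (2 * j) = 1 := by
      rw [pow_mul, pow_two (quarterTurn ^ 2), quarterTurn_sq_mul_self, one_pow]
    have hW : altProd B A (c :: t) =
        (quarterTurn ^ 2) ^ j * (cfProd (c :: t) * quarterTurn⁻¹) := by
      rw [cfProd_eq_altProd, hj, pow_succ quarterTurn (2 * j), hz,
        ← mul_assoc (altProd B A (c :: t)), mul_inv_cancel_right,
        ← ((quarterTurn_sq_commute (altProd B A (c :: t))).pow_left j).eq, ← mul_assoc,
        ← pow_add, ← two_mul, hz1, one_mul]
    have hconj (Z V H : SL2Z) (h : Commute Z H) :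
        (Z * V)⁻¹ * H * (Z * V) = V⁻¹ * H * V := by
      rw [mul_inv_rev]
      calc V⁻¹ * Z⁻¹ * H * (Z * V) = V⁻¹ * Z⁻¹ * (H * Z) * V := by simp only [mul_assoc]
        _ = V⁻¹ * H * V := by rw [← h.eq]; group
    rw [hW, hconj _ _ _ ((quarterTurn_sq_commute _).pow_left j), A_inv_mul_B_inv, bPrime1,
      cfProd_append, cfProd_append, List.tail_cons, cfProd_neg_reverse, ht, hz1]
    simp only [cfProd, List.headD_cons]
    group

theorem scfe_bPrime1 (b : List ℤ) (hb : SCFE b) (h0 : b.headD 0 ≠ 0) (h1 : b.headD 0 ≠ 1) :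
    (bPrime1 b).IsChain (fun x y => x * y ≤ 0) ∧ (∀ x ∈ bPrime1 b, x ≠ 0) ∧
      2 ≤ |(bPrime1 b).getLastD 0| := by
  obtain ⟨hne, hc, hnz, hl⟩ := (scfe_iff b).1 hb
  cases b with
  | nil => exact absurd rfl hne
  | cons c t =>
    simp only [List.headD_cons, List.tail_cons] at h0 h1 hnz
    simp only [bPrime1, List.headD_cons, List.tail_cons]
    refine ⟨?_, ?_, ?_⟩
    · have hrev : (((1 - c) :: t.map fun x => -x).reverse ++ c :: t).IsChain
          (fun x y => x * y ≤ 0) := by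
        rw [List.isChain_append, List.isChain_reverse]
        refine ⟨?_, hc, ?_⟩
        · rw [List.isChain_cons] at hc ⊢
          refine ⟨?_, ?_⟩
          · intro y hy
            rw [List.head?_map, Option.mem_map] at hy
            obtain ⟨d, hd, rfl⟩ := hy
            have hcd := hc.1 d hd
            have hd0 := hnz d (List.mem_of_mem_head? hd)
            show -d * (1 - c) ≤ 0
            rcases lt_or_gt_of_ne h0 with h | h
            · have : 0 ≤ d := by nlinarith
              nlinarith
            · have : d ≤ 0 := by nlinarith
              have : 2 ≤ c := by omega
              nlinarith
          · rw [List.isChain_map]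
            exact hc.2.imp fun x y h => by simpa [mul_comm] using h
        · intro x hx y hy
          simp at hx hy
          subst hx hy
          rcases lt_or_gt_of_ne h0 with h | h
          · nlinarith
          · have : 2 ≤ c := by omega
            nlinarith
      simpa using hrev
    · intro x hx
      simp only [List.mem_append, List.mem_reverse, List.mem_map, List.mem_cons,
        List.not_mem_nil, or_false] at hx
      rcases hx with (⟨y, hy, rfl⟩ | rfl) | rfl | hx
      · exact neg_ne_zero.2 (hnz y hy)
      · omega
      · exact h0
      · exact hnz x hx
    · rw [List.getLastD_eq_getLast?] at hl ⊢
      rwa [List.getLast?_append_of_ne_nil _ hne]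

/-- for a SCFE `(b_1, …, b_k)` with `k` odd, `b_1 ∉ {0, 1}` and value `≠ ±1`,
setting `W = B^{b_1} A^{b_2} ⋯ B^{b_k}`, `H = A⁻¹ B⁻¹`, `X(N) = (W A^N)⁻¹ H (W A^N)` with
first column `(p(N), q(N))`: (i) `q(N)` is independent of `N`; (ii) `q(N) ≠ 0` and
`p(N)/q(N) = N + cf(b'_1)` where `b'_1 = (−b_k, …, −b_2, −b_1 + 1, b_1, …, b_k)`; and
(iii) `b'_1` is itself a SCFE. -/
theorem X_of_N_description (b : List ℤ) (hb : SCFE b) (hodd : Odd b.length)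
    (h0 : b.headD 0 ≠ 0) (h1 : b.headD 0 ≠ 1)
    (hv1 : cf b ≠ 1) (hv2 : cf b ≠ -1) :
    (∀ N M : ℤ, qEnt b N = qEnt b M) ∧
    (∀ N : ℤ, qEnt b N ≠ 0 ∧
      (pEnt b N : ℚ) / (qEnt b N : ℚ) = (N : ℚ) + cf (bPrime1 b)) ∧
    SCFE (bPrime1 b) := by
  obtain ⟨hc, hnz, hl⟩ := scfe_bPrime1 b hb h0 h1
  have hne : bPrime1 b ≠ [] := by simp [bPrime1]
  have hwd : cfWD (bPrime1 b) := by
    obtain ⟨c, t, hct⟩ := List.exists_cons_of_ne_nil hne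
    rw [hct] at hc hnz hl ⊢
    exact (cfWD_and_cf_bounds c t hc hnz hl).1
  obtain ⟨hq0, hcf⟩ := cf_eq_cfProd _ hwd
  have hX (N : ℤ) : Xmat b N = A ^ (-N) * (cfProd (bPrime1 b) * quarterTurn⁻¹) * A ^ N := by
    rw [← conj_altProd_eq_cfProd b hodd, Xmat]
    group
  have hq (N : ℤ) : qEnt b N = cfProd (bPrime1 b) 1 1 := by
    rw [qEnt, hX]
    simp only [Matrix.SpecialLinearGroup.coe_mul, Matrix.SpecialLinearGroup.coe_inv, coe_A_zpow,
      coe_quarterTurn]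
    simp [Matrix.vecMul, dotProduct, Matrix.mul_apply, Fin.sum_univ_two, Matrix.adjugate_fin_two]
  have hp (N : ℤ) : pEnt b N = cfProd (bPrime1 b) 0 1 + N * cfProd (bPrime1 b) 1 1 := by
    rw [pEnt, hX]
    simp only [Matrix.SpecialLinearGroup.coe_mul, Matrix.SpecialLinearGroup.coe_inv, coe_A_zpow,
      coe_quarterTurn]
    simp [Matrix.vecMul, dotProduct, Matrix.mul_apply, Fin.sum_univ_two, Matrix.adjugate_fin_two]
  refine ⟨fun N M => by rw [hq, hq], fun N => ⟨by rwa [hq], ?_⟩,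
    (scfe_iff _).2 ⟨hne, hc, fun x hx => hnz x (List.mem_of_mem_tail hx), hl⟩⟩
  have hq0' : ((cfProd (bPrime1 b) 1 1 : ℤ) : ℚ) ≠ 0 := by exact_mod_cast hq0
  rw [hp, hq, hcf]
  push_cast
  field_simp
  ring
end

section
/- Let p and q be coprime integers with q ≠ 0, let n be an odd positive integer, and let (r_n, r_{n−1}, …, r_1) be a list of integers whose evaluation is well-defined. Let W = B^{r_n} A^{r_{n−1}} B^{r_{n−2}} ⋯ B^{r_1} ∈ SL(2, ℤ) (letters alternating, starting and ending with a power of B since n is odd). Then p/q = cf(r_n, r_{n−1}, …, r_1) if and only if W · (1, 0)ᵀ = (p, q)ᵀ or W · (1, 0)ᵀ = (−p, −q)ᵀ. -/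
/-- The first column `(x, y)` of an alternating word computes the continued fraction: it is
`-y / x` for words of even length ending in `B`, and `x / y` for words of odd length. -/
theorem cf_eq_column_ratio (r : List ℤ) (hwd : cfWD r) :
    (Even r.length → (altProd A B r).1 0 0 ≠ 0 ∧
      cf r = -((altProd A B r).1 1 0 : ℚ) / (altProd A B r).1 0 0) ∧
    (Odd r.length → (altProd B A r).1 1 0 ≠ 0 ∧
      cf r = ((altProd B A r).1 0 0 : ℚ) / (altProd B A r).1 1 0) := by
  induction r with
  | nil => simp [altProd, cf]
  | cons b t ih =>
    obtain ⟨hb, ht⟩ := hwd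
    obtain ⟨ihe, iho⟩ := ih ht
    have hb' := sub_ne_zero.mpr hb
    constructor
    · intro h
      obtain ⟨hy, hc⟩ := iho (by simpa [Nat.even_add_one] using h)
      have e0 : (altProd A B (b :: t)).1 0 0 =
          (altProd B A t).1 0 0 - b * (altProd B A t).1 1 0 := by
        simp [altProd, coe_A_zpow, Matrix.mul_apply, Fin.sum_univ_two, sub_eq_add_neg]
      have e1 : (altProd A B (b :: t)).1 1 0 = (altProd B A t).1 1 0 := by
        simp [altProd, coe_A_zpow, Matrix.mul_apply, Fin.sum_univ_two]
      rw [e0, e1, cf]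
      generalize (altProd B A t).1 0 0 = x at *
      generalize (altProd B A t).1 1 0 = y at *
      have hyQ : (y : ℚ) ≠ 0 := by exact_mod_cast hy
      have hx : ((x - b * y : ℤ) : ℚ) = -(b - cf t) * y := by
        rw [hc]; push_cast; field_simp; ring
      refine ⟨fun h0 => ?_, ?_⟩
      · rw [h0, Int.cast_zero] at hx
        exact mul_ne_zero (neg_ne_zero.mpr hb') hyQ hx.symm
      · rw [hx]; field_simp
    · intro h
      obtain ⟨hx, hc⟩ := ihe (by simpa [Nat.odd_add_one] using h)
      have e0 : (altProd B A (b :: t)).1 0 0 = (altProd A B t).1 0 0 := by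
        simp [altProd, coe_B_zpow, Matrix.mul_apply, Fin.sum_univ_two]
      have e1 : (altProd B A (b :: t)).1 1 0 =
          b * (altProd A B t).1 0 0 + (altProd A B t).1 1 0 := by
        simp [altProd, coe_B_zpow, Matrix.mul_apply, Fin.sum_univ_two]
      rw [e0, e1, cf]
      generalize (altProd A B t).1 0 0 = x at *
      generalize (altProd A B t).1 1 0 = y at *
      have hxQ : (x : ℚ) ≠ 0 := by exact_mod_cast hx
      have hy : ((b * x + y : ℤ) : ℚ) = (b - cf t) * x := by
        rw [hc]; push_cast; field_simp; ring
      refine ⟨fun h0 => ?_, ?_⟩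
      · rw [h0, Int.cast_zero] at hy
        exact mul_ne_zero hb' hxQ hy.symm
      · rw [hy]; field_simp

theorem Matrix.SpecialLinearGroup.isCoprime_first_column {R : Type*} [CommRing R]
    (g : Matrix.SpecialLinearGroup (Fin 2) R) : IsCoprime (g.1 0 0) (g.1 1 0) := by
  have h := g.det_coe
  rw [Matrix.det_fin_two] at h
  exact ⟨g.1 1 1, -g.1 0 1, by linear_combination h⟩

theorem Int.div_eq_div_iff_of_isCoprime {p q x y : ℤ} (hpq : IsCoprime p q)
    (hxy : IsCoprime x y) (hq : q ≠ 0) (hy : y ≠ 0) :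
    (p : ℚ) / q = x / y ↔ (x = p ∧ y = q) ∨ (x = -p ∧ y = -q) := by
  have hqQ : (q : ℚ) ≠ 0 := by exact_mod_cast hq
  have hyQ : (y : ℚ) ≠ 0 := by exact_mod_cast hy
  rw [div_eq_div_iff hqQ hyQ]
  norm_cast
  constructor
  · intro h
    have hqy : q ∣ y := hpq.symm.dvd_of_dvd_mul_left ⟨x, by rw [h]; ring⟩
    have hyq : y ∣ q := hxy.symm.dvd_of_dvd_mul_left ⟨p, by rw [← h]; ring⟩
    rcases Int.associated_iff.mp (associated_of_dvd_dvd hyq hqy) with e | e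
    · subst e
      exact Or.inl ⟨(mul_right_cancel₀ hq h).symm, rfl⟩
    · subst e
      exact Or.inr ⟨mul_right_cancel₀ hq (by linear_combination -h), rfl⟩
  · rintro (⟨rfl, rfl⟩ | ⟨rfl, rfl⟩) <;> ring

/-- for coprime integers `p, q` with `q ≠ 0` and a list `(r_n, …, r_1)` of odd
positive length with well-defined evaluation, `p/q = cf(r_n, …, r_1)` if and only if the
alternating word `W = B^{r_n} A^{r_{n-1}} ⋯ B^{r_1}` has first column `(p, q)` or `(−p, −q)`. -/
theorem slope_iff_column (p q : ℤ) (hpq : IsCoprime p q) (hq : q ≠ 0)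
    (r : List ℤ) (hodd : Odd r.length) (hpos : 0 < r.length) (hwd : cfWD r) :
    (p : ℚ) / (q : ℚ) = cf r ↔
      (((altProd B A r : Matrix (Fin 2) (Fin 2) ℤ) 0 0 = p ∧
        (altProd B A r : Matrix (Fin 2) (Fin 2) ℤ) 1 0 = q) ∨
       ((altProd B A r : Matrix (Fin 2) (Fin 2) ℤ) 0 0 = -p ∧
        (altProd B A r : Matrix (Fin 2) (Fin 2) ℤ) 1 0 = -q)) := by
  obtain ⟨hy, hc⟩ := (cf_eq_column_ratio r hwd).2 hodd
  rw [hc]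
  exact Int.div_eq_div_iff_of_isCoprime hpq
    (Matrix.SpecialLinearGroup.isCoprime_first_column _) hq hy
end
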